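/- Let σ' > 0 satisfy E[exp(σ' H¹)] < ∞, where H^x is the total number of births of the Galton-Watson process. Then every f in the class F = {f : ℕ∪{0} → ℝ : ∑_{ℓ≥0} e^{−ρℓ}|f(ℓ)| < ∞ for some ρ < σ'} satisfies the Kolmogorov equations for the reflected Galton-Watson process: d/dt S̃_t f = Q̃ S̃_t f = S̃_t Q̃ f, where Q̃ f(x) = ∑_{ℓ≥−1} x p(ℓ+1) 1{x+ℓ ≥ 1}(f(x+ℓ) − f(x)) is the reflected generator and S̃_t its semigroup. -/

import Mathlib

open MeasureTheory Filter Topology Set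

noncomputable section

/-- Jump rates of the continuous-time Galton-Watson process: from `x ≥ 1`,
jump to `x - 1` at rate `x p(0)` and to `y > x` at rate `x p(y - x + 1)`;
the state `0` is absorbing. -/
def gwRate (p : ℕ → ℝ) (x y : ℕ) : ℝ :=
  if 1 ≤ x ∧ y + 1 = x then (x : ℝ) * p 0
  else if 1 ≤ x ∧ x < y then (x : ℝ) * p (y - x + 1)
  else 0

/-- The offspring law: a probability on ℕ with a finite positive exponential
moment and negative (subcritical) drift `-v = ∑_{ℓ ≥ -1} ℓ p(ℓ+1) < 0`. -/
structure OffspringLaw (p : ℕ → ℝ) (σ v : ℝ) : Prop where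
  nonneg : ∀ k, 0 ≤ p k
  total : ∑' k : ℕ, p k = 1
  sigma_pos : 0 < σ
  expMoment : Summable fun k : ℕ => p k * Real.exp (σ * k)
  v_pos : 0 < v
  drift : ∑' k : ℕ, ((k : ℝ) - 1) * p k = -v

/-- Empirical distribution of an `N`-particle configuration. -/
def emp (N : ℕ) (x : ℕ) (ξ : Fin N → ℕ) : ℝ :=
  (N : ℝ)⁻¹ * ∑ i : Fin N, (if ξ i = x then (1 : ℝ) else 0)

/-- Fleming-Viot generator for general driving rates `q`. -/
def fvGenQ (q : ℕ → ℕ → ℝ) (N : ℕ) (f : (Fin N → ℕ) → ℝ) (ξ : Fin N → ℕ) : ℝ :=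
  ∑ i : Fin N, ∑' y : ℕ,
    (if 1 ≤ y then
        q (ξ i) y + q (ξ i) 0 * ((N : ℝ) / ((N : ℝ) - 1)) * emp N y ξ
      else 0) * (f (Function.update ξ i y) - f ξ)

/-- Fleming-Viot generator driven by the Galton-Watson rates. -/
def fvGen (p : ℕ → ℝ) (N : ℕ) : ((Fin N → ℕ) → ℝ) → (Fin N → ℕ) → ℝ :=
  fvGenQ (gwRate p) N

/-- Bounded real observables. -/
def Bounded {S : Type*} (f : S → ℝ) : Prop := ∃ C, ∀ x, |f x| ≤ C

/-- A Markov transition semigroup on a measurable state space. -/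
structure MarkovSemigroup (S : Type*) [MeasurableSpace S] where
  P : ℝ → S → Measure S
  meas : ∀ t, Measurable (P t)
  prob : ∀ t x, IsProbabilityMeasure (P t x)
  init : ∀ x, P 0 x = Measure.dirac x
  semigroup : ∀ s t : ℝ, 0 ≤ s → 0 ≤ t → ∀ x, P (s + t) x = (P s x).bind (P t)

/-- `K` is the transition semigroup of the `N`-particle Fleming-Viot process
driven by the rates `q`: it solves the Kolmogorov equation for the
Fleming-Viot generator on bounded observables. -/
def IsFVQSemigroup (q : ℕ → ℕ → ℝ) (N : ℕ) (K : MarkovSemigroup (Fin N → ℕ)) : Prop :=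
  ∀ f : (Fin N → ℕ) → ℝ, Bounded f → Measurable f → ∀ ξ, ∀ t : ℝ, 0 ≤ t →
    HasDerivWithinAt (fun u => ∫ η, f η ∂ K.P u ξ)
      (∫ η, fvGenQ q N f η ∂ K.P t ξ) (Set.Ici 0) t

/-- `K` is the `N`-particle Fleming-Viot semigroup driven by Galton-Watson. -/
def IsFVSemigroup (p : ℕ → ℝ) (N : ℕ) (K : MarkovSemigroup (Fin N → ℕ)) : Prop :=
  IsFVQSemigroup (gwRate p) N K

/-- Invariant (stationary) measure of a Markov semigroup. -/
def Invariant {S : Type*} [MeasurableSpace S] (K : MarkovSemigroup S) (μ : Measure S) : Prop :=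
  ∀ t : ℝ, 0 ≤ t → μ.bind (K.P t) = μ

/-- Transition probabilities of the Galton-Watson process (absorbed at 0),
characterized by the Kolmogorov backward equations. -/
structure GWTransition (p : ℕ → ℝ) where
  pt : ℝ → ℕ → ℕ → ℝ
  nonneg : ∀ t x y, 0 ≤ pt t x y
  total : ∀ t x, 0 ≤ t → ∑' y : ℕ, pt t x y = 1
  init : ∀ x y, pt 0 x y = if y = x then 1 else 0
  backward : ∀ x y, ∀ t : ℝ, 0 ≤ t →
    HasDerivWithinAt (fun s => pt s x y)
      (∑' z : ℕ, gwRate p x z * (pt t z y - pt t x y)) (Set.Ici 0) t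

/-- The law at time `t` of the process started from `μ`, conditioned on
non-absorption up to time `t`. -/
def condLaw (pt : ℝ → ℕ → ℕ → ℝ) (μ : ℕ → ℝ) (t : ℝ) (y : ℕ) : ℝ :=
  (∑' x : ℕ, μ x * pt t x y) /
    ∑' x : ℕ, ∑' z : ℕ, (if 1 ≤ z then μ x * pt t x z else 0)

def diracOne : ℕ → ℝ := fun x => if x = 1 then 1 else 0

/-- `ν` is the Yaglom limit (the minimal quasi-stationary distribution). -/
def IsYaglomLimit (pt : ℝ → ℕ → ℕ → ℝ) (ν : ℕ → ℝ) : Prop :=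
  ∀ y : ℕ, Tendsto (fun t => condLaw pt diracOne t y) atTop (𝓝 (ν y))

/-- Position of the rightmost particle. -/
def rmax (N : ℕ) (ξ : Fin N → ℕ) : ℕ := Finset.univ.sup ξ

/-- Ratio of the second to the first empirical moment. -/
def psiFun (N : ℕ) (ξ : Fin N → ℕ) : ℝ :=
  (∑ i : Fin N, (ξ i : ℝ) ^ 2) / ∑ i : Fin N, (ξ i : ℝ)

/-- Configurations of the multitype branching process: `ζ (i, x)` is the
number of type-`i` individuals at site `x`. -/
abbrev BConf (N : ℕ) := Fin N × ℕ → ℕ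

/-- Total number of individuals. -/
def bTotal (N : ℕ) (ζ : BConf N) : ENNReal := ∑' w : Fin N × ℕ, (ζ w : ENNReal)

/-- Rightmost occupied site. -/
def bRmax (N : ℕ) (ζ : BConf N) : ℕ := sSup {x : ℕ | ∃ i, ζ (i, x) ≠ 0}

/-- Move one type-`i` individual from `x` to `y`. -/
def bJump (N : ℕ) (ζ : BConf N) (i : Fin N) (x y : ℕ) : BConf N :=
  fun w => if w = (i, x) then ζ w - 1 else if w = (i, y) then ζ w + 1 else ζ w

/-- Every type-`j` individual gives birth to a type-`i` individual at its own
position. -/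
def bBranch (N : ℕ) (ζ : BConf N) (i j : Fin N) : BConf N :=
  fun w => if w.1 = i then ζ w + ζ (j, w.2) else ζ w

/-- Generator of the multitype branching Markov process. -/
def branchGen (q : ℕ → ℕ → ℝ) (qbar : ℝ) (N : ℕ) (f : BConf N → ℝ) (ζ : BConf N) : ℝ :=
  (∑' w : (Fin N × ℕ) × ℕ,
      (ζ w.1 : ℝ) * (if w.2 ≠ 0 ∧ w.2 ≠ w.1.2 then q w.1.2 w.2 else 0) *
        (f (bJump N ζ w.1.1 w.1.2 w.2) - f ζ))
    + ∑ i : Fin N, ∑ j : Fin N,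
        (if j ≠ i then qbar / ((N : ℝ) - 1) * (f (bBranch N ζ i j) - f ζ) else 0)

def IsBranchSemigroup (q : ℕ → ℕ → ℝ) (qbar : ℝ) (N : ℕ)
    (B : MarkovSemigroup (BConf N)) : Prop :=
  ∀ f : BConf N → ℝ, Bounded f → Measurable f → ∀ ζ, ∀ t : ℝ, 0 ≤ t →
    HasDerivWithinAt (fun u => ∫ η, f η ∂ B.P u ζ)
      (∫ η, branchGen q qbar N f η ∂ B.P t ζ) (Set.Ici 0) t

/-- Generator of the single-particle motion with jumps to `0` suppressed. -/
def tildeGen (q : ℕ → ℕ → ℝ) (f : ℕ → ℝ) (x : ℕ) : ℝ :=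
  ∑' y : ℕ, (if y ≠ 0 ∧ y ≠ x then q x y else 0) * (f y - f x)

def IsTildeSemigroup (q : ℕ → ℕ → ℝ) (T : MarkovSemigroup ℕ) : Prop :=
  ∀ f : ℕ → ℝ, Bounded f → ∀ x, ∀ t : ℝ, 0 ≤ t →
    HasDerivWithinAt (fun u => ∫ y, f y ∂ T.P u x)
      (∫ y, tildeGen q f y ∂ T.P t x) (Set.Ici 0) t

/-- Generator of the Galton-Watson process together with its cumulative birth
counter: from `(z, b)`, jump to `(z + k - 1, b + k)` at rate `z p(k)`. -/
def gwbGen (p : ℕ → ℝ) (f : ℕ × ℕ → ℝ) (w : ℕ × ℕ) : ℝ :=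
  ∑' k : ℕ, (w.1 : ℝ) * p k * (f (w.1 + k - 1, w.2 + k) - f w)

def IsGWBSemigroup (p : ℕ → ℝ) (W : MarkovSemigroup (ℕ × ℕ)) : Prop :=
  ∀ f : ℕ × ℕ → ℝ, Bounded f → ∀ w, ∀ t : ℝ, 0 ≤ t →
    HasDerivWithinAt (fun u => ∫ z, f z ∂ W.P u w)
      (∫ z, gwbGen p f z ∂ W.P t w) (Set.Ici 0) t

/-- `E[exp(σ' H¹)] < ∞`, where `H¹ = 1 + (total number of births)` of the
Galton-Watson process started from one individual; the total number of births
is the increasing limit of the birth counter. -/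
def HMomentFinite (W : MarkovSemigroup (ℕ × ℕ)) (σ' : ℝ) : Prop :=
  ∃ M : ℝ, ∀ t : ℝ, 0 ≤ t →
    ∫⁻ w, ENNReal.ofReal (Real.exp (σ' * (1 + (w.2 : ℝ)))) ∂ W.P t (1, 0)
      ≤ ENNReal.ofReal M

/-- The class `F` of test functions: `∑_ℓ e^{-ρℓ} |f(ℓ)| < ∞` for some `ρ < σ'`. -/
def MemF (σ' : ℝ) (f : ℕ → ℝ) : Prop :=
  ∃ ρ : ℝ, ρ < σ' ∧ Summable fun ℓ : ℕ => Real.exp (-ρ * ℓ) * |f ℓ|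

/-- Galton-Watson semigroup `S_t f(x) = E f(Z^x_t)`, read off from the
birth-counting process. -/
def gwS (W : MarkovSemigroup (ℕ × ℕ)) (t : ℝ) (f : ℕ → ℝ) (x : ℕ) : ℝ :=
  ∫ w, f w.1 ∂ W.P t (x, 0)

/-- Galton-Watson generator `Q f(x) = ∑_{ℓ ≥ -1} x p(ℓ+1) (f(x+ℓ) - f(x))`. -/
def gwQ (p : ℕ → ℝ) (f : ℕ → ℝ) (x : ℕ) : ℝ :=
  ∑' k : ℕ, (x : ℝ) * p k * (f (x + k - 1) - f x)

/-- Reflected Galton-Watson generator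
`Q̃ f(x) = ∑_{ℓ ≥ -1} x p(ℓ+1) 1{x+ℓ ≥ 1} (f(x+ℓ) - f(x))`. -/
def gwQRefl (p : ℕ → ℝ) (f : ℕ → ℝ) (x : ℕ) : ℝ :=
  ∑' k : ℕ, (x : ℝ) * p k * (if 1 ≤ x + k - 1 then f (x + k - 1) - f x else 0)

def IsReflSemigroup (p : ℕ → ℝ) (R : MarkovSemigroup ℕ) : Prop :=
  ∀ f : ℕ → ℝ, Bounded f → ∀ x, ∀ t : ℝ, 0 ≤ t →
    HasDerivWithinAt (fun u => ∫ y, f y ∂ R.P u x)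
      (∫ y, gwQRefl p f y ∂ R.P t x) (Set.Ici 0) t

/-- `Γ(ρ) = p(0) + ∑_{ℓ ≥ 1} p(ℓ+1) ℓ² e^{ρℓ}`. -/
def gwGamma (p : ℕ → ℝ) (ρ : ℝ) : ℝ :=
  p 0 + ∑' ℓ : ℕ, p (ℓ + 2) * ((ℓ : ℝ) + 1) ^ 2 * Real.exp (ρ * ((ℓ : ℝ) + 1))

/-- `β = sup {ρ > 0 : ρ Γ(ρ) ≤ v}`. -/
def gwBeta (p : ℕ → ℝ) (v : ℝ) : ℝ :=
  sSup {ρ : ℝ | 0 < ρ ∧ ρ * gwGamma p ρ ≤ v}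

/-- Generating function `G(μ; z) = ∑_x μ(x) z^x`. -/
def genFn (μ : ℕ → ℝ) (z : ℝ) : ℝ := ∑' x : ℕ, μ x * z ^ x

/-- A probability distribution on the positive integers. -/
def IsProbOnPos (μ : ℕ → ℝ) : Prop :=
  (∀ x, 0 ≤ μ x) ∧ μ 0 = 0 ∧ ∑' x : ℕ, μ x = 1

/-- The class `K(α)`: probabilities on ℕ whose second-to-first moment ratio
is at most `α`. -/
def InK (α : ℝ) (μ : ℕ → ℝ) : Prop :=
  IsProbOnPos μ ∧ (Summable fun x : ℕ => (x : ℝ) ^ 2 * μ x) ∧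
    (∑' x : ℕ, (x : ℝ) ^ 2 * μ x) ≤ α * ∑' x : ℕ, (x : ℝ) * μ x

theorem le_exp_mul_of_hasDerivWithinAt_le {u u' : ℝ → ℝ} {a c : ℝ}
    (hu : ∀ t, 0 ≤ t → HasDerivWithinAt u (u' t) (Ici 0) t)
    (h : ∀ t, 0 ≤ t → u' t ≤ a * (u t - c)) {t : ℝ} (ht : 0 ≤ t) :
    u t - c ≤ Real.exp (a * t) * (u 0 - c) := by
  have hexp : ∀ s, HasDerivAt (fun s => Real.exp (-a * s)) (Real.exp (-a * s) * -a) s := by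
    intro s
    simpa using ((hasDerivAt_id s).const_mul (-a)).exp
  have hg : ∀ s, 0 ≤ s → HasDerivWithinAt (fun s => Real.exp (-a * s) * (u s - c))
      (Real.exp (-a * s) * -a * (u s - c) + Real.exp (-a * s) * u' s) (Ici 0) s := fun s hs =>
    (hexp s).hasDerivWithinAt.mul ((hu s hs).sub_const c)
  have hanti : AntitoneOn (fun s => Real.exp (-a * s) * (u s - c)) (Ici 0) := by
    refine antitoneOn_of_hasDerivWithinAt_nonpos (convex_Ici 0)
      (fun s hs => (hg s hs).continuousWithinAt)
      (fun s hs => (hg s (interior_subset hs)).mono interior_subset) (fun s hs => ?_)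
    have h1 := h s (interior_subset hs)
    nlinarith [mul_nonneg (Real.exp_pos (-a * s)).le (sub_nonneg.2 h1)]
  have h0 := hanti (mem_Ici.2 le_rfl) (mem_Ici.2 ht) ht
  have h2 : Real.exp (a * t) * Real.exp (-a * t) = 1 := by
    rw [← Real.exp_add]; simp
  have h3 : Real.exp (a * t) * (Real.exp (-a * t) * (u t - c)) ≤
      Real.exp (a * t) * (Real.exp (-a * 0) * (u 0 - c)) :=
    mul_le_mul_of_nonneg_left h0 (Real.exp_pos _).le
  rw [← mul_assoc, h2] at h3
  simpa using h3

/-- A pointwise limit on `[0, ∞)` is differentiable as soon as the derivatives converge jointly in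
the index and the time variable. -/
theorem hasDerivWithinAt_Ici_of_tendsto_prod {F G : ℕ → ℝ → ℝ} {f : ℝ → ℝ} {t g : ℝ} (ht : 0 ≤ t)
    (hF : ∀ n s, 0 ≤ s → HasDerivWithinAt (F n) (G n s) (Ici 0) s)
    (hlim : ∀ s, 0 ≤ s → Tendsto (fun n => F n s) atTop (𝓝 (f s)))
    (hG : Tendsto (fun q : ℕ × ℝ => G q.1 q.2) (atTop ×ˢ 𝓝[Ici 0] t) (𝓝 g)) :
    HasDerivWithinAt f g (Ici 0) t := by
  rw [hasDerivWithinAt_iff_isLittleO, Asymptotics.isLittleO_iff]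
  intro ε hε
  have h1 := hG.eventually (Metric.ball_mem_nhds g hε)
  obtain ⟨pn, hpn, ps, hps, hq⟩ := Filter.eventually_prod_iff.1 h1
  obtain ⟨r, hr, hball⟩ := Metric.mem_nhdsWithin_iff.1 hps
  have hmem : Metric.ball t r ∩ Ici 0 ∈ 𝓝[Ici 0] t :=
    inter_comm (Ici (0 : ℝ)) _ ▸ inter_mem_nhdsWithin _ (Metric.ball_mem_nhds t hr)
  filter_upwards [hmem] with s hs
  have hconv : Convex ℝ (Metric.ball t r ∩ Ici 0) := (convex_ball t r).inter (convex_Ici 0)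
  have htm : t ∈ Metric.ball t r ∩ Ici 0 := ⟨Metric.mem_ball_self hr, ht⟩
  have hl : Tendsto (fun n => ‖F n s - s * g - (F n t - t * g)‖) atTop
      (𝓝 ‖f s - s * g - (f t - t * g)‖) :=
    (((hlim s hs.2).sub_const _).sub ((hlim t ht).sub_const _)).norm
  have hb : ‖f s - s * g - (f t - t * g)‖ ≤ ε * ‖s - t‖ := by
    refine le_of_tendsto hl ?_
    filter_upwards [hpn] with n hn
    refine hconv.norm_image_sub_le_of_norm_hasDerivWithin_le (f := fun s => F n s - s * g)
      (f' := fun s => G n s - 1 * g) (fun y hy => ?_) (fun y hy => ?_) htm hs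
    · exact ((hF n y hy.2).mono inter_subset_right).sub
        ((hasDerivWithinAt_id y _).mul_const g)
    · have := hq hn (hball hy)
      rw [dist_eq_norm] at this
      simpa using this.le
  have heq : f s - f t - (s - t) • g = f s - s * g - (f t - t * g) := by
    rw [smul_eq_mul]; ring
  rwa [heq]

theorem bounded_of_eq_zero_of_lt {g : ℕ → ℝ} (n : ℕ) (h : ∀ z, n < z → g z = 0) : Bounded g := by
  refine ⟨∑ i ∈ Finset.range (n + 1), |g i|, fun z => ?_⟩
  by_cases hz : n < z
  · rw [h z hz, abs_zero]
    exact Finset.sum_nonneg fun _ _ => abs_nonneg _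
  · exact Finset.single_le_sum (f := fun i => |g i|) (fun _ _ => abs_nonneg _)
      (Finset.mem_range.2 (by omega))

theorem Bounded.integrable {S : Type*} [MeasurableSpace S] [DiscreteMeasurableSpace S]
    [Countable S] {g : S → ℝ} (hg : Bounded g) (μ : Measure S) [IsProbabilityMeasure μ] :
    Integrable g μ := by
  obtain ⟨C, hC⟩ := hg
  exact Integrable.of_bound Measurable.of_discrete.aestronglyMeasurable C (ae_of_all _ hC)

theorem OffspringLaw.summable {p : ℕ → ℝ} {σ v : ℝ} (hp : OffspringLaw p σ v) : Summable p := by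
  by_contra h
  have := hp.total
  rw [tsum_eq_zero_of_not_summable h] at this
  exact zero_ne_one this

/-- The exponential test function capped at level `n`. -/
def cappedExp (ρ : ℝ) (n z : ℕ) : ℝ := Real.exp (ρ * min (z : ℝ) n)

theorem cappedExp_pos (ρ : ℝ) (n z : ℕ) : 0 < cappedExp ρ n z := Real.exp_pos _

theorem cappedExp_bounded {ρ : ℝ} (hρ : 0 ≤ ρ) (n : ℕ) : Bounded (cappedExp ρ n) := by
  refine ⟨Real.exp (ρ * n), fun z => ?_⟩
  rw [abs_of_pos (cappedExp_pos _ _ _)]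
  exact Real.exp_le_exp.2 (mul_le_mul_of_nonneg_left (min_le_right _ _) hρ)

theorem cappedExp_le {ρ : ℝ} (hρ : 0 ≤ ρ) (n z : ℕ) : cappedExp ρ n z ≤ Real.exp (ρ * z) :=
  Real.exp_le_exp.2 (mul_le_mul_of_nonneg_left (min_le_left _ _) hρ)

theorem cappedExp_of_le {ρ : ℝ} {n z : ℕ} (h : z ≤ n) : cappedExp ρ n z = Real.exp (ρ * z) := by
  rw [cappedExp, min_eq_left (Nat.cast_le.2 h)]

theorem cappedExp_of_ge {ρ : ℝ} {n z : ℕ} (h : n ≤ z) : cappedExp ρ n z = Real.exp (ρ * n) := by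
  rw [cappedExp, min_eq_right (Nat.cast_le.2 h)]

theorem gwQ_cappedExp_of_lt (p : ℕ → ℝ) (ρ : ℝ) {n z : ℕ} (h : n < z) :
    gwQ p (cappedExp ρ n) z = 0 := by
  have : ∀ k : ℕ, (z : ℝ) * p k * (cappedExp ρ n (z + k - 1) - cappedExp ρ n z) = 0 := by
    intro k
    rw [cappedExp_of_ge (show n ≤ z + k - 1 by omega), cappedExp_of_ge h.le, sub_self, mul_zero]
  simp only [gwQ, this, tsum_zero]

theorem gwQRefl_eq_zero_of_const (p : ℕ → ℝ) {g : ℕ → ℝ} {n z : ℕ} {c : ℝ}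
    (hg : ∀ y, n ≤ y → g y = c) (h : n < z) : gwQRefl p g z = 0 := by
  have : ∀ k : ℕ, (z : ℝ) * p k * (if 1 ≤ z + k - 1 then g (z + k - 1) - g z else 0) = 0 := by
    intro k
    rw [hg _ (show n ≤ z + k - 1 by omega), hg _ h.le, sub_self, ite_self, mul_zero]
  simp only [gwQRefl, this, tsum_zero]

/-- The truncated tilted moments `∑ p(k) e^{ρ min(k - 1, m)}`. -/
def cappedTilt (p : ℕ → ℝ) (ρ : ℝ) (m : ℕ) : ℝ :=
  ∑' k : ℕ, p k * Real.exp (ρ * min ((k : ℝ) - 1) m)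

theorem summable_mul_exp_min {p : ℕ → ℝ} (hs : Summable p) (hp : ∀ k, 0 ≤ p k) {ρ : ℝ}
    (hρ : 0 ≤ ρ) (m : ℝ) : Summable fun k : ℕ => p k * Real.exp (ρ * min ((k : ℝ) - 1) m) := by
  refine Summable.of_nonneg_of_le (fun k => mul_nonneg (hp k) (Real.exp_pos _).le)
    (fun k => mul_le_mul_of_nonneg_left ?_ (hp k)) (hs.mul_right (Real.exp (ρ * m)))
  exact Real.exp_le_exp.2 (mul_le_mul_of_nonneg_left (min_le_right _ _) hρ)

theorem summable_tilt_of_cappedTilt_le_one {p : ℕ → ℝ} (hs : Summable p) (hp : ∀ k, 0 ≤ p k)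
    {ρ : ℝ} (hρ : 0 ≤ ρ) (h : ∀ m, cappedTilt p ρ m ≤ 1) :
    (Summable fun k : ℕ => p k * Real.exp (ρ * ((k : ℝ) - 1))) ∧
      ∑' k : ℕ, p k * Real.exp (ρ * ((k : ℝ) - 1)) ≤ 1 := by
  have hnn : 0 ≤ fun k : ℕ => p k * Real.exp (ρ * ((k : ℝ) - 1)) := fun k =>
    mul_nonneg (hp k) (Real.exp_pos _).le
  have hfin : ∀ u : Finset ℕ, ∑ k ∈ u, p k * Real.exp (ρ * ((k : ℝ) - 1)) ≤ 1 := by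
    intro u
    refine le_trans ?_ (h (u.sup id))
    refine le_trans (le_of_eq ?_) ((summable_mul_exp_min hs hp hρ ((u.sup id : ℕ) : ℝ)).sum_le_tsum u
      fun k _ => mul_nonneg (hp k) (Real.exp_pos _).le)
    refine Finset.sum_congr rfl fun k hk => ?_
    have h1 : (k : ℝ) ≤ (u.sup id : ℕ) := Nat.cast_le.2 (Finset.le_sup (f := id) hk)
    rw [min_eq_left (by linarith)]
  exact ⟨summable_of_sum_le hnn hfin, Real.tsum_le_of_sum_le hnn hfin⟩

theorem gwQ_eq_of_bounded {p : ℕ → ℝ} (hp : ∀ k, 0 ≤ p k) (hs : Summable p)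
    (htot : ∑' k, p k = 1) {g : ℕ → ℝ} (hg : Bounded g) (z : ℕ) :
    gwQ p g z = z * (∑' k, p k * g (z + k - 1) - g z) := by
  obtain ⟨C, hC⟩ := hg
  have h1 : Summable fun k => p k * g (z + k - 1) := by
    refine Summable.of_norm_bounded (hs.mul_right C) fun k => ?_
    rw [norm_mul, Real.norm_of_nonneg (hp k)]
    exact mul_le_mul_of_nonneg_left (hC _) (hp k)
  have h2 : ∑' k, p k * g z = g z := by rw [tsum_mul_right, htot, one_mul]
  calc gwQ p g z = ∑' k, (z : ℝ) * (p k * g (z + k - 1) - p k * g z) :=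
        tsum_congr fun k => by ring
    _ = _ := by rw [tsum_mul_left, h1.tsum_sub (hs.mul_right _), h2]

theorem cast_add_sub_one {z : ℕ} (hz : 1 ≤ z) (k : ℕ) :
    ((z + k - 1 : ℕ) : ℝ) = z + ((k : ℝ) - 1) := by
  rw [Nat.cast_sub (by omega)]; push_cast; ring

theorem le_gwQ_cappedExp {p : ℕ → ℝ} (hp : ∀ k, 0 ≤ p k) (hs : Summable p)
    (htot : ∑' k, p k = 1) {ρ σ' δ η : ℝ} (hρ : 0 ≤ ρ) (hδ : 0 ≤ δ) (hη : 0 ≤ η) {m N : ℕ}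
    (hm : 1 + δ ≤ cappedTilt p ρ m)
    (hN : ∀ z : ℕ, N ≤ z → (z + δ) * Real.exp (ρ * z) ≤ η * Real.exp (σ' * z)) (z : ℕ) :
    δ * (cappedExp ρ (N + m) z - 1) - η * Real.exp (σ' * z) ≤ gwQ p (cappedExp ρ (N + m)) z := by
  set n := N + m with hn
  have hE : 0 ≤ η * Real.exp (σ' * z) := mul_nonneg hη (Real.exp_pos _).le
  have hVb := cappedExp_bounded hρ n
  by_cases hzN : N ≤ z
  · have h1 := hN z hzN
    have h2 := cappedExp_le hρ n z
    have h3 : δ * cappedExp ρ n z ≤ δ * Real.exp (ρ * z) := mul_le_mul_of_nonneg_left h2 hδ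
    have h4 : -(z * cappedExp ρ n z) ≤ gwQ p (cappedExp ρ n) z := by
      rw [gwQ_eq_of_bounded hp hs htot hVb]
      have : 0 ≤ ∑' k, p k * cappedExp ρ n (z + k - 1) :=
        tsum_nonneg fun k => mul_nonneg (hp k) (cappedExp_pos _ _ _).le
      nlinarith [mul_nonneg (Nat.cast_nonneg (α := ℝ) z) this]
    have h5 : (z : ℝ) * cappedExp ρ n z ≤ z * Real.exp (ρ * z) :=
      mul_le_mul_of_nonneg_left h2 (Nat.cast_nonneg z)
    linarith
  · rcases Nat.eq_zero_or_pos z with rfl | hz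
    · have : gwQ p (cappedExp ρ n) 0 = 0 := by simp [gwQ]
      rw [this, cappedExp_of_le (Nat.zero_le n)]
      simpa using hη
    · rw [gwQ_eq_of_bounded hp hs htot hVb]
      have hV : cappedExp ρ n z = Real.exp (ρ * z) := cappedExp_of_le (by omega)
      have h1 : Real.exp (ρ * z) * cappedTilt p ρ m ≤ ∑' k, p k * cappedExp ρ n (z + k - 1) := by
        rw [cappedTilt, ← tsum_mul_left]
        refine Summable.tsum_le_tsum (fun k => ?_)
          ((summable_mul_exp_min hs hp hρ (m : ℝ)).mul_left _) ?_
        · rw [mul_left_comm, ← Real.exp_add]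
          refine mul_le_mul_of_nonneg_left (Real.exp_le_exp.2 ?_) (hp k)
          rw [← mul_add]
          refine mul_le_mul_of_nonneg_left (le_min ?_ ?_) hρ
          · rw [cast_add_sub_one hz]
            exact add_le_add_right (min_le_left _ _) _
          · refine (add_le_add_right (min_le_right _ _) _).trans ?_
            rw [← Nat.cast_add]
            exact Nat.cast_le.2 (by omega)
        · obtain ⟨C, hC⟩ := hVb
          refine Summable.of_norm_bounded (hs.mul_right C) fun k => ?_
          rw [norm_mul, Real.norm_of_nonneg (hp k)]
          exact mul_le_mul_of_nonneg_left (hC _) (hp k)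
      rw [hV]
      have hz1 : (1 : ℝ) ≤ z := by exact_mod_cast hz
      have he := Real.exp_pos (ρ * z)
      have h2 : δ * Real.exp (ρ * z) ≤
          ∑' k, p k * cappedExp ρ n (z + k - 1) - Real.exp (ρ * z) := by
        nlinarith [mul_le_mul_of_nonneg_left hm he.le]
      have h3 : 0 ≤ δ * Real.exp (ρ * z) := mul_nonneg hδ he.le
      nlinarith [mul_le_mul_of_nonneg_left h2 (sub_nonneg.2 hz1)]

/-- Weight detecting the configurations in which the population exceeds the number of births
plus one. -/
def excessWeight (w : ℕ × ℕ) : ℝ := if w.2 + 1 < w.1 then 1 / ((w.1 : ℝ) + 1) else 0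

theorem excessWeight_nonneg (w : ℕ × ℕ) : 0 ≤ excessWeight w := by
  unfold excessWeight; split_ifs <;> positivity

theorem excessWeight_le_one (w : ℕ × ℕ) : excessWeight w ≤ 1 := by
  unfold excessWeight
  split_ifs
  · rw [div_le_one (by positivity)]
    have : (0 : ℝ) ≤ w.1 := Nat.cast_nonneg _
    linarith
  · exact zero_le_one

theorem gwbGen_excessWeight {p : ℕ → ℝ} (hp : ∀ k, 0 ≤ p k) (hs : Summable p)
    (htot : ∑' k, p k = 1) (w : ℕ × ℕ) :
    gwbGen p excessWeight w ≤ excessWeight w ∧ |gwbGen p excessWeight w| ≤ 1 := by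
  obtain ⟨z, b⟩ := w
  by_cases hb : b + 1 < z
  · have hz2 : (2 : ℝ) ≤ z := by exact_mod_cast (by omega : 2 ≤ z)
    have hw : excessWeight (z, b) = 1 / ((z : ℝ) + 1) := if_pos hb
    have hup : ∀ k, (z : ℝ) * p k * (excessWeight (z + k - 1, b + k) - excessWeight (z, b)) ≤
        p k * excessWeight (z, b) := by
      intro k
      have h1 : excessWeight (z + k - 1, b + k) ≤ 1 / z := by
        unfold excessWeight
        split_ifs
        · refine one_div_le_one_div_of_le (by linarith) ?_
          simp only
          rw [cast_add_sub_one (by omega)]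
          have : (0 : ℝ) ≤ k := Nat.cast_nonneg _
          linarith
        · positivity
      have h2 : (z : ℝ) * (excessWeight (z + k - 1, b + k) - excessWeight (z, b)) ≤
          excessWeight (z, b) := by
        calc (z : ℝ) * (excessWeight (z + k - 1, b + k) - excessWeight (z, b))
            ≤ z * (1 / z - excessWeight (z, b)) := by gcongr
          _ = excessWeight (z, b) := by rw [hw]; field_simp; ring
      calc (z : ℝ) * p k * (excessWeight (z + k - 1, b + k) - excessWeight (z, b))
          = p k * (z * (excessWeight (z + k - 1, b + k) - excessWeight (z, b))) := by ring
        _ ≤ _ := mul_le_mul_of_nonneg_left h2 (hp k)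
    have hlow : ∀ k, -p k ≤
        (z : ℝ) * p k * (excessWeight (z + k - 1, b + k) - excessWeight (z, b)) := by
      intro k
      have h1 := excessWeight_nonneg (z + k - 1, b + k)
      have h2 : (z : ℝ) * excessWeight (z, b) ≤ 1 := by
        rw [hw, mul_one_div, div_le_one (by positivity)]; linarith
      have h3 : -1 ≤ (z : ℝ) * (excessWeight (z + k - 1, b + k) - excessWeight (z, b)) := by
        nlinarith [mul_nonneg (by linarith : (0 : ℝ) ≤ z) h1]
      nlinarith [mul_le_mul_of_nonneg_left h3 (hp k)]
    have hnorm : ∀ k,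
        ‖(z : ℝ) * p k * (excessWeight (z + k - 1, b + k) - excessWeight (z, b))‖ ≤ p k := by
      intro k
      rw [Real.norm_eq_abs, abs_le]
      exact ⟨hlow k, (hup k).trans (mul_le_of_le_one_right (hp k) (excessWeight_le_one _))⟩
    constructor
    · calc gwbGen p excessWeight (z, b) ≤ ∑' k, p k * excessWeight (z, b) :=
            (Summable.of_norm_bounded hs hnorm).tsum_le_tsum hup (hs.mul_right _)
        _ = _ := by rw [tsum_mul_right, htot, one_mul]
    · exact tsum_of_norm_bounded (htot ▸ hs.hasSum) hnorm
  · have hterm : ∀ k, (z : ℝ) * p k *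
        (excessWeight (z + k - 1, b + k) - excessWeight (z, b)) = 0 := by
      intro k
      rcases Nat.eq_zero_or_pos z with rfl | hz
      · simp
      · have h1 : excessWeight (z + k - 1, b + k) = 0 := if_neg (by simp only; omega)
        have h2 : excessWeight (z, b) = 0 := if_neg hb
        rw [h1, h2, sub_self, mul_zero]
    have h0 : gwbGen p excessWeight (z, b) = 0 := by
      simp only [gwbGen, hterm, tsum_zero]
    rw [h0]
    exact ⟨excessWeight_nonneg _, by simp⟩

/-- Started from a single individual, the population never exceeds one plus the number of
births. -/
theorem IsGWBSemigroup.ae_fst_le {p : ℕ → ℝ} {W : MarkovSemigroup (ℕ × ℕ)}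
    (hW : IsGWBSemigroup p W) (hp : ∀ k, 0 ≤ p k) (hs : Summable p) (htot : ∑' k, p k = 1)
    {t : ℝ} (ht : 0 ≤ t) : ∀ᵐ w ∂W.P t (1, 0), w.1 ≤ w.2 + 1 := by
  have hbd : Bounded excessWeight := ⟨1, fun w => by
    rw [abs_of_nonneg (excessWeight_nonneg w)]; exact excessWeight_le_one w⟩
  have hbd' : Bounded (gwbGen p excessWeight) := ⟨1, fun w => (gwbGen_excessWeight hp hs htot w).2⟩
  have hgr := le_exp_mul_of_hasDerivWithinAt_le (a := 1) (c := 0)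
    (hW excessWeight hbd (1, 0)) (fun s _ => by
      have := W.prob s (1, 0)
      rw [one_mul, sub_zero]
      exact integral_mono (hbd'.integrable _) (hbd.integrable _)
        fun w => (gwbGen_excessWeight hp hs htot w).1) ht
  have := W.prob t (1, 0)
  have h0 : ∫ z, excessWeight z ∂W.P 0 (1, 0) = 0 := by
    rw [W.init, integral_dirac]; simp [excessWeight]
  rw [h0, sub_zero, sub_zero, mul_zero] at hgr
  have hz : ∫ z, excessWeight z ∂W.P t (1, 0) = 0 :=
    le_antisymm hgr (integral_nonneg excessWeight_nonneg)
  rw [integral_eq_zero_iff_of_nonneg excessWeight_nonneg (hbd.integrable _)] at hz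
  filter_upwards [hz] with w hw
  by_contra hlt
  have : excessWeight w = 1 / ((w.1 : ℝ) + 1) := if_pos (by omega)
  rw [this] at hw
  have : (0 : ℝ) < 1 / ((w.1 : ℝ) + 1) := by positivity
  exact this.ne' hw

theorem exists_nat_add_mul_exp_le {ρ σ' δ η : ℝ} (h : ρ < σ') (hη : 0 < η) :
    ∃ N : ℕ, ∀ z : ℕ, N ≤ z → (z + δ) * Real.exp (ρ * z) ≤ η * Real.exp (σ' * z) := by
  have hε : 0 < σ' - ρ := sub_pos.2 h
  have hlin : Tendsto (fun z : ℕ => (σ' - ρ) * (z : ℝ)) atTop atTop :=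
    tendsto_natCast_atTop_atTop.const_mul_atTop hε
  have h1 := (Real.tendsto_pow_mul_exp_neg_atTop_nhds_zero 1).comp hlin
  have h0 := (Real.tendsto_pow_mul_exp_neg_atTop_nhds_zero 0).comp hlin
  have h2 := (h1.const_mul (σ' - ρ)⁻¹).add (h0.const_mul δ)
  simp only [mul_zero, add_zero] at h2
  obtain ⟨N, hN⟩ := Filter.eventually_atTop.1 (h2.eventually (eventually_le_nhds hη))
  refine ⟨N, fun z hz => ?_⟩
  have h3 := hN z hz
  simp only [Function.comp_apply, pow_one, pow_zero, one_mul] at h3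
  have h4 : (z + δ) * Real.exp (-((σ' - ρ) * z)) ≤ η := by
    refine le_trans (le_of_eq ?_) h3
    field_simp
  have h5 : Real.exp (ρ * z) = Real.exp (-((σ' - ρ) * z)) * Real.exp (σ' * z) := by
    rw [← Real.exp_add]; congr 1; ring
  rw [h5, ← mul_assoc]
  exact mul_le_mul_of_nonneg_right h4 (Real.exp_pos _).le

theorem HMomentFinite.exists_integral_exp_le {p : ℕ → ℝ} {W : MarkovSemigroup (ℕ × ℕ)} {σ' : ℝ}
    (hH : HMomentFinite W σ') (hW : IsGWBSemigroup p W) (hp : ∀ k, 0 ≤ p k) (hs : Summable p)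
    (htot : ∑' k, p k = 1) (hσ' : 0 ≤ σ') :
    ∃ M, 0 < M ∧ ∀ t, 0 ≤ t →
      Integrable (fun w : ℕ × ℕ => Real.exp (σ' * w.1)) (W.P t (1, 0)) ∧
        ∫ w, Real.exp (σ' * w.1) ∂W.P t (1, 0) ≤ M := by
  obtain ⟨M, hM⟩ := hH
  refine ⟨max M 1, by positivity, fun t ht => ?_⟩
  have hle : ∫⁻ w, ENNReal.ofReal (Real.exp (σ' * w.1)) ∂W.P t (1, 0) ≤ ENNReal.ofReal M := by
    refine (lintegral_mono_ae ?_).trans (hM t ht)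
    filter_upwards [hW.ae_fst_le hp hs htot ht] with w hw
    refine ENNReal.ofReal_le_ofReal (Real.exp_le_exp.2 (mul_le_mul_of_nonneg_left ?_ hσ'))
    rw [add_comm]
    exact_mod_cast hw
  have hnn : 0 ≤ᵐ[W.P t (1, 0)] fun w : ℕ × ℕ => Real.exp (σ' * w.1) :=
    ae_of_all _ fun w => (Real.exp_pos _).le
  have hint : Integrable (fun w : ℕ × ℕ => Real.exp (σ' * w.1)) (W.P t (1, 0)) :=
    ⟨Measurable.of_discrete.aestronglyMeasurable,
      (hasFiniteIntegral_iff_ofReal hnn).2 (hle.trans_lt ENNReal.ofReal_lt_top)⟩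
  refine ⟨hint, ?_⟩
  rw [← ofReal_integral_eq_lintegral_ofReal hint hnn] at hle
  exact (ENNReal.ofReal_le_ofReal_iff (by positivity)).1
    (hle.trans (ENNReal.ofReal_le_ofReal (le_max_left _ _)))

theorem cappedTilt_le_one {p : ℕ → ℝ} {W : MarkovSemigroup (ℕ × ℕ)} {σ' : ℝ}
    (hH : HMomentFinite W σ') (hW : IsGWBSemigroup p W) (hp : ∀ k, 0 ≤ p k) (hs : Summable p)
    (htot : ∑' k, p k = 1) {ρ : ℝ} (hρ : 0 < ρ) (hρσ : ρ < σ') (m : ℕ) :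
    cappedTilt p ρ m ≤ 1 := by
  by_contra! hlt
  obtain ⟨M, hM0, hM⟩ := hH.exists_integral_exp_le hW hp hs htot (hρ.trans hρσ).le
  set δ := cappedTilt p ρ m - 1 with hδdef
  have hδ : 0 < δ := sub_pos.2 hlt
  have he1 : 0 < Real.exp ρ - 1 := sub_pos.2 (Real.one_lt_exp_iff.2 hρ)
  set η := δ * (Real.exp ρ - 1) / (2 * M) with hηdef
  have hη : 0 < η := by positivity
  obtain ⟨N', hN'⟩ := exists_nat_add_mul_exp_le (δ := δ) hρσ hη
  have hN : ∀ z : ℕ, N' + 1 ≤ z → (z + δ) * Real.exp (ρ * z) ≤ η * Real.exp (σ' * z) :=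
    fun z hz => hN' z (by omega)
  set n := N' + 1 + m with hn
  have hpt := le_gwQ_cappedExp hp hs htot hρ.le hδ.le hη.le (m := m) (by linarith) hN
  set V : ℕ × ℕ → ℝ := fun w => cappedExp ρ n w.1 with hV
  have hVb : Bounded V := by
    obtain ⟨C, hC⟩ := cappedExp_bounded hρ.le n
    exact ⟨C, fun w => hC w.1⟩
  have hLb : Bounded (gwbGen p V) := by
    obtain ⟨C, hC⟩ := bounded_of_eq_zero_of_lt n fun z hz => gwQ_cappedExp_of_lt p ρ hz
    exact ⟨C, fun w => hC w.1⟩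
  have hder := hW V hVb (1, 0)
  have hineq : ∀ t, 0 ≤ t → δ * (∫ w, V w ∂W.P t (1, 0) - 1) - η * M ≤
      ∫ w, gwbGen p V w ∂W.P t (1, 0) := by
    intro t ht
    have := W.prob t (1, 0)
    obtain ⟨hint, hle⟩ := hM t ht
    have hVi := hVb.integrable (W.P t (1, 0))
    have hVi1 : Integrable (fun w => V w - 1) (W.P t (1, 0)) := hVi.sub (integrable_const _)
    have h1 : ∫ w, (δ * (V w - 1) - η * Real.exp (σ' * w.1)) ∂W.P t (1, 0) ≤
        ∫ w, gwbGen p V w ∂W.P t (1, 0) :=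
      integral_mono ((hVi1.const_mul δ).sub (hint.const_mul η)) (hLb.integrable _)
        fun w => hpt w.1
    rw [integral_sub (hVi1.const_mul δ) (hint.const_mul η), integral_const_mul,
      integral_const_mul, integral_sub hVi (integrable_const _)] at h1
    simp only [integral_const, probReal_univ, smul_eq_mul, mul_one] at h1
    nlinarith [mul_le_mul_of_nonneg_left hle hη.le]
  have hgrow : ∀ t, 0 ≤ t →
      Real.exp (δ * t) * ((Real.exp ρ - 1) / 2) ≤ M := by
    intro t ht
    have hg := le_exp_mul_of_hasDerivWithinAt_le (a := δ) (c := -(1 + η * M / δ))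
      (fun s hs => (hder s hs).neg) (fun s hs => by
        have := hineq s hs
        have h2 : δ * (η * M / δ) = η * M := by field_simp
        simp only [Pi.neg_apply]
        linarith) ht
    have h0 : ∫ w, V w ∂W.P 0 (1, 0) = Real.exp ρ := by
      rw [W.init, integral_dirac]
      simp only [hV]
      rw [cappedExp_of_le (by omega)]; simp
    have hc : η * M / δ = (Real.exp ρ - 1) / 2 := by
      rw [hηdef]; field_simp
    simp only [Pi.neg_apply, h0, hc] at hg
    obtain ⟨hint, hle⟩ := hM t ht
    have := W.prob t (1, 0)
    have hVM : ∫ w, V w ∂W.P t (1, 0) ≤ M :=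
      (integral_mono (hVb.integrable _) hint fun w =>
        (cappedExp_le hρ.le n w.1).trans (Real.exp_le_exp.2
          (mul_le_mul_of_nonneg_right hρσ.le (Nat.cast_nonneg _)))).trans hle
    nlinarith
  have htend : Tendsto (fun t : ℝ => Real.exp (δ * t) * ((Real.exp ρ - 1) / 2)) atTop atTop :=
    (Real.tendsto_exp_atTop.comp (tendsto_id.const_mul_atTop hδ)).atTop_mul_const (by positivity)
  obtain ⟨t, ht0, ht⟩ := ((eventually_ge_atTop 0).and (htend.eventually_gt_atTop M)).exists
  exact absurd (hgrow t ht0) (not_le.2 ht)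

theorem gwQRefl_cappedExp_le {p : ℕ → ℝ} (hp : ∀ k, 0 ≤ p k) (hs : Summable p)
    (htot : ∑' k, p k = 1) {ρ : ℝ} (hρ : 0 ≤ ρ)
    (hsum : Summable fun k : ℕ => p k * Real.exp (ρ * ((k : ℝ) - 1)))
    (hone : ∑' k : ℕ, p k * Real.exp (ρ * ((k : ℝ) - 1)) ≤ 1) (n z : ℕ) :
    gwQRefl p (cappedExp ρ n) z ≤ (Real.exp ρ - 1) * cappedExp ρ n z := by
  have hc : 0 ≤ Real.exp ρ - 1 := sub_nonneg.2 (Real.one_le_exp hρ)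
  have hV1 : 1 ≤ cappedExp ρ n z :=
    Real.one_le_exp (mul_nonneg hρ (le_min (Nat.cast_nonneg _) (Nat.cast_nonneg _)))
  by_cases hzn : n < z
  · rw [gwQRefl_eq_zero_of_const p (fun y hy => cappedExp_of_ge hy) hzn]
    exact mul_nonneg hc (zero_le_one.trans hV1)
  rcases Nat.eq_zero_or_pos z with rfl | hz
  · have : gwQRefl p (cappedExp ρ n) 0 = 0 := by simp [gwQRefl]
    rw [this]
    exact mul_nonneg hc (zero_le_one.trans hV1)
  have hV : cappedExp ρ n z = Real.exp (ρ * z) := cappedExp_of_le (by omega)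
  have hstep : ∀ k : ℕ, cappedExp ρ n (z + k - 1) ≤
      Real.exp (ρ * z) * Real.exp (ρ * ((k : ℝ) - 1)) := by
    intro k
    refine (cappedExp_le hρ n _).trans (le_of_eq ?_)
    rw [cast_add_sub_one hz, mul_add, Real.exp_add]
  have hterm : ∀ k : ℕ, (z : ℝ) * p k *
      (if 1 ≤ z + k - 1 then cappedExp ρ n (z + k - 1) - cappedExp ρ n z else 0) ≤
      z * Real.exp (ρ * z) * (p k * Real.exp (ρ * ((k : ℝ) - 1)) - p k) +
        p k * (Real.exp ρ - 1) := by
    intro k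
    split_ifs with hk
    · have h1 : (z : ℝ) * p k * (cappedExp ρ n (z + k - 1) - cappedExp ρ n z) ≤
          z * p k * (Real.exp (ρ * z) * Real.exp (ρ * ((k : ℝ) - 1)) - Real.exp (ρ * z)) := by
        rw [hV]
        exact mul_le_mul_of_nonneg_left (sub_le_sub_right (hstep k) _)
          (mul_nonneg (Nat.cast_nonneg _) (hp k))
      have h2 := mul_nonneg (hp k) hc
      linarith
    · obtain rfl : z = 1 := by omega
      obtain rfl : k = 0 := by omega
      have h3 : Real.exp ρ * Real.exp (-ρ) = 1 := by rw [← Real.exp_add]; simp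
      simp only [Nat.cast_one, Nat.cast_zero, mul_one, one_mul, mul_zero, zero_sub, mul_neg]
      linear_combination (-p 0) * h3
  have hsR : Summable fun k : ℕ =>
      z * Real.exp (ρ * z) * (p k * Real.exp (ρ * ((k : ℝ) - 1)) - p k) :=
    (hsum.sub hs).mul_left _
  have hsL : Summable fun k : ℕ => (z : ℝ) * p k *
      (if 1 ≤ z + k - 1 then cappedExp ρ n (z + k - 1) - cappedExp ρ n z else 0) := by
    obtain ⟨C, hC⟩ := cappedExp_bounded hρ n
    have hC0 : 0 ≤ C := (abs_nonneg _).trans (hC 0)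
    refine Summable.of_norm_bounded ((hs.mul_left (z : ℝ)).mul_right (C + C)) fun k => ?_
    rw [norm_mul, Real.norm_of_nonneg (mul_nonneg (Nat.cast_nonneg z) (hp k))]
    refine mul_le_mul_of_nonneg_left ?_ (mul_nonneg (Nat.cast_nonneg z) (hp k))
    split_ifs
    · exact (norm_sub_le _ _).trans (add_le_add (hC _) (hC _))
    · simpa using add_nonneg hC0 hC0
  calc gwQRefl p (cappedExp ρ n) z
      ≤ ∑' k : ℕ, (z * Real.exp (ρ * z) * (p k * Real.exp (ρ * ((k : ℝ) - 1)) - p k) +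
        p k * (Real.exp ρ - 1)) := hsL.tsum_le_tsum hterm (hsR.add (hs.mul_right _))
    _ = z * Real.exp (ρ * z) * (∑' k : ℕ, p k * Real.exp (ρ * ((k : ℝ) - 1)) - 1) +
        (Real.exp ρ - 1) := by
      rw [hsR.tsum_add (hs.mul_right _), tsum_mul_left, hsum.tsum_sub hs, tsum_mul_right, htot,
        one_mul]
    _ ≤ Real.exp ρ - 1 := by
      have : (z : ℝ) * Real.exp (ρ * z) * (∑' k : ℕ, p k * Real.exp (ρ * ((k : ℝ) - 1)) - 1) ≤ 0 :=
        mul_nonpos_of_nonneg_of_nonpos (by positivity) (sub_nonpos.2 hone)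
      linarith
    _ ≤ _ := le_mul_of_one_le_right hc hV1

/-- Exponential moments of the reflected process grow at most exponentially in time. -/
theorem IsReflSemigroup.integral_exp_le {p : ℕ → ℝ} {R : MarkovSemigroup ℕ}
    (hR : IsReflSemigroup p R) (hp : ∀ k, 0 ≤ p k) (hs : Summable p)
    (htot : ∑' k, p k = 1) {ρ : ℝ} (hρ : 0 ≤ ρ)
    (hsum : Summable fun k : ℕ => p k * Real.exp (ρ * ((k : ℝ) - 1)))
    (hone : ∑' k : ℕ, p k * Real.exp (ρ * ((k : ℝ) - 1)) ≤ 1) (x : ℕ) {t : ℝ} (ht : 0 ≤ t) :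
    Integrable (fun y : ℕ => Real.exp (ρ * y)) (R.P t x) ∧
      ∫ y : ℕ, Real.exp (ρ * y) ∂ R.P t x ≤ Real.exp ((Real.exp ρ - 1) * t) * Real.exp (ρ * x) := by
  have := R.prob t x
  set B := Real.exp ((Real.exp ρ - 1) * t) * Real.exp (ρ * x) with hB
  have hcap : ∀ n, ∫ y, cappedExp ρ n y ∂ R.P t x ≤ B := by
    intro n
    have hVb := cappedExp_bounded hρ n
    have hLb : Bounded (gwQRefl p (cappedExp ρ n)) :=
      bounded_of_eq_zero_of_lt n fun z hz =>
        gwQRefl_eq_zero_of_const p (fun y hy => cappedExp_of_ge hy) hz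
    have hg := le_exp_mul_of_hasDerivWithinAt_le (a := Real.exp ρ - 1) (c := 0)
      (hR _ hVb x) (fun s _ => by
        have := R.prob s x
        rw [sub_zero, ← integral_const_mul]
        exact integral_mono (hLb.integrable _) ((hVb.integrable _).const_mul _)
          fun z => gwQRefl_cappedExp_le hp hs htot hρ hsum hone n z) ht
    rw [R.init, integral_dirac, sub_zero, sub_zero] at hg
    exact hg.trans (mul_le_mul_of_nonneg_left (cappedExp_le hρ n x) (Real.exp_pos _).le)
  have hnn : 0 ≤ᵐ[R.P t x] fun y : ℕ => Real.exp (ρ * y) := ae_of_all _ fun y => (Real.exp_pos _).le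
  have hle : ∫⁻ y : ℕ, ENNReal.ofReal (Real.exp (ρ * y)) ∂ R.P t x ≤ ENNReal.ofReal B := by
    have hmono : Tendsto (fun n => ∫⁻ y, ENNReal.ofReal (cappedExp ρ n y) ∂ R.P t x) atTop
        (𝓝 (∫⁻ y : ℕ, ENNReal.ofReal (Real.exp (ρ * y)) ∂ R.P t x)) := by
      refine lintegral_tendsto_of_tendsto_of_monotone
        (fun n => Measurable.of_discrete.aemeasurable) (ae_of_all _ fun y n n' hn => ?_)
        (ae_of_all _ fun y => ?_)
      · refine ENNReal.ofReal_le_ofReal (Real.exp_le_exp.2 (mul_le_mul_of_nonneg_left ?_ hρ))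
        exact min_le_min_left _ (Nat.cast_le.2 hn)
      · refine tendsto_const_nhds.congr' ?_
        filter_upwards [eventually_ge_atTop y] with n hn
        rw [cappedExp_of_le hn]
    refine le_of_tendsto' hmono fun n => ?_
    rw [← ofReal_integral_eq_lintegral_ofReal ((cappedExp_bounded hρ n).integrable _)
      (ae_of_all _ fun y => (cappedExp_pos _ _ _).le)]
    exact ENNReal.ofReal_le_ofReal (hcap n)
  have hint : Integrable (fun y : ℕ => Real.exp (ρ * y)) (R.P t x) :=
    ⟨Measurable.of_discrete.aestronglyMeasurable,
      (hasFiniteIntegral_iff_ofReal hnn).2 (hle.trans_lt ENNReal.ofReal_lt_top)⟩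
  refine ⟨hint, ?_⟩
  rw [← ofReal_integral_eq_lintegral_ofReal hint hnn] at hle
  exact (ENNReal.ofReal_le_ofReal_iff (by positivity)).1 hle

/-- Functions growing at most like `C e^{ρ y}`. -/
def ExpGrowth (ρ C : ℝ) (f : ℕ → ℝ) : Prop := ∀ y : ℕ, |f y| ≤ C * Real.exp (ρ * y)

theorem ExpGrowth.nonneg {ρ C : ℝ} {f : ℕ → ℝ} (h : ExpGrowth ρ C f) : 0 ≤ C := by
  simpa using (abs_nonneg _).trans (h 0)

/-- `f` restricted to the states above `n`. -/
def tailPart (n : ℕ) (f : ℕ → ℝ) (y : ℕ) : ℝ := if y ≤ n then 0 else f y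

/-- `f` restricted to the states up to `n`. -/
def headPart (n : ℕ) (f : ℕ → ℝ) (y : ℕ) : ℝ := if y ≤ n then f y else 0

theorem headPart_add_tailPart (n : ℕ) (f : ℕ → ℝ) : headPart n f + tailPart n f = f := by
  funext y
  simp only [Pi.add_apply, headPart, tailPart]
  split_ifs <;> simp

theorem headPart_bounded (n : ℕ) (f : ℕ → ℝ) : Bounded (headPart n f) :=
  bounded_of_eq_zero_of_lt n fun _ hz => if_neg (not_le.2 hz)

theorem gwQRefl_headPart_bounded (p : ℕ → ℝ) (n : ℕ) (f : ℕ → ℝ) :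
    Bounded (gwQRefl p (headPart n f)) :=
  bounded_of_eq_zero_of_lt (n + 1) fun _ hz =>
    gwQRefl_eq_zero_of_const p (n := n + 1) (c := 0)
      (fun _ hy => if_neg (by omega)) hz

theorem ExpGrowth.headPart {ρ C : ℝ} {f : ℕ → ℝ} (h : ExpGrowth ρ C f) (n : ℕ) :
    ExpGrowth ρ C (headPart n f) := by
  intro y
  unfold _root_.headPart
  split_ifs
  · exact h y
  · simpa using mul_nonneg h.nonneg (Real.exp_pos _).le

theorem ExpGrowth.tailPart {ρ ρ' C : ℝ} {f : ℕ → ℝ} (h : ExpGrowth ρ C f) (hρ : ρ ≤ ρ') (n : ℕ) :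
    ExpGrowth ρ' (C * Real.exp (-(ρ' - ρ) * n)) (tailPart n f) := by
  intro y
  unfold _root_.tailPart
  split_ifs with hy
  · rw [abs_zero]
    exact mul_nonneg (mul_nonneg h.nonneg (Real.exp_pos _).le) (Real.exp_pos _).le
  · refine (h y).trans ?_
    rw [mul_assoc, ← Real.exp_add]
    refine mul_le_mul_of_nonneg_left (Real.exp_le_exp.2 ?_) h.nonneg
    have : (n : ℝ) ≤ y := Nat.cast_le.2 (by omega)
    nlinarith [mul_le_mul_of_nonneg_left this (sub_nonneg.2 hρ)]

theorem ExpGrowth.norm_gwQRefl_term_le {p : ℕ → ℝ} (hp : ∀ k, 0 ≤ p k) {ρ C : ℝ} (hρ : 0 ≤ ρ)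
    {f : ℕ → ℝ} (h : ExpGrowth ρ C f) (z k : ℕ) :
    ‖(z : ℝ) * p k * (if 1 ≤ z + k - 1 then f (z + k - 1) - f z else 0)‖ ≤
      2 * C * (z * Real.exp (ρ * z)) * (p k * Real.exp (ρ * k)) := by
  have hC := h.nonneg
  rw [norm_mul, Real.norm_of_nonneg (mul_nonneg (Nat.cast_nonneg z) (hp k))]
  have hb : ‖if 1 ≤ z + k - 1 then f (z + k - 1) - f z else 0‖ ≤
      2 * C * (Real.exp (ρ * z) * Real.exp (ρ * k)) := by
    rw [← Real.exp_add, ← mul_add]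
    split_ifs
    · have hle : ∀ y : ℕ, (y : ℝ) ≤ z + k → |f y| ≤ C * Real.exp (ρ * (z + k)) := fun y hy =>
        (h y).trans (mul_le_mul_of_nonneg_left
          (Real.exp_le_exp.2 (mul_le_mul_of_nonneg_left hy hρ)) hC)
      have h1 := hle (z + k - 1) (by rw [← Nat.cast_add]; exact Nat.cast_le.2 (by omega))
      have h2 := hle z (by rw [← Nat.cast_add]; exact Nat.cast_le.2 (by omega))
      have h3 := norm_sub_le (f (z + k - 1)) (f z)
      simp only [Real.norm_eq_abs] at h3 ⊢
      linarith
    · rw [norm_zero]; positivity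
  calc _ ≤ (z : ℝ) * p k * (2 * C * (Real.exp (ρ * z) * Real.exp (ρ * k))) :=
        mul_le_mul_of_nonneg_left hb (mul_nonneg (Nat.cast_nonneg z) (hp k))
    _ = _ := by ring

theorem ExpGrowth.summable_gwQRefl {p : ℕ → ℝ} (hp : ∀ k, 0 ≤ p k) {ρ C : ℝ} (hρ : 0 ≤ ρ)
    (hsum : Summable fun k : ℕ => p k * Real.exp (ρ * k)) {f : ℕ → ℝ} (h : ExpGrowth ρ C f)
    (z : ℕ) : Summable fun k : ℕ =>
      (z : ℝ) * p k * (if 1 ≤ z + k - 1 then f (z + k - 1) - f z else 0) :=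
  Summable.of_norm_bounded (hsum.mul_left _) fun k => h.norm_gwQRefl_term_le hp hρ z k

theorem ExpGrowth.gwQRefl {p : ℕ → ℝ} (hp : ∀ k, 0 ≤ p k) {ρ ρ' C : ℝ} (hρ : 0 ≤ ρ) (hρ' : ρ < ρ')
    (hsum : Summable fun k : ℕ => p k * Real.exp (ρ * k)) {f : ℕ → ℝ} (h : ExpGrowth ρ C f) :
    ExpGrowth ρ' (C * (2 * (∑' k : ℕ, p k * Real.exp (ρ * k)) / (ρ' - ρ))) (gwQRefl p f) := by
  intro z
  have hC := h.nonneg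
  set A := ∑' k : ℕ, p k * Real.exp (ρ * k) with hA
  have hA0 : 0 ≤ A := tsum_nonneg fun k => mul_nonneg (hp k) (Real.exp_pos _).le
  have hε : 0 < ρ' - ρ := sub_pos.2 hρ'
  have h1 : |_root_.gwQRefl p f z| ≤ 2 * C * (z * Real.exp (ρ * z)) * A :=
    tsum_of_norm_bounded (hsum.hasSum.mul_left _) fun k => h.norm_gwQRefl_term_le hp hρ z k
  have h2 : (z : ℝ) * Real.exp (ρ * z) ≤ Real.exp (ρ' * z) / (ρ' - ρ) := by
    rw [le_div_iff₀ hε]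
    have h3 : (ρ' - ρ) * z ≤ Real.exp ((ρ' - ρ) * z) := by
      linarith [Real.add_one_le_exp ((ρ' - ρ) * z)]
    calc (z : ℝ) * Real.exp (ρ * z) * (ρ' - ρ) = (ρ' - ρ) * z * Real.exp (ρ * z) := by ring
      _ ≤ Real.exp ((ρ' - ρ) * z) * Real.exp (ρ * z) :=
        mul_le_mul_of_nonneg_right h3 (Real.exp_pos _).le
      _ = Real.exp (ρ' * z) := by rw [← Real.exp_add]; congr 1; ring
  calc _ ≤ 2 * C * (z * Real.exp (ρ * z)) * A := h1
    _ ≤ 2 * C * (Real.exp (ρ' * z) / (ρ' - ρ)) * A := by gcongr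
    _ = _ := by ring

theorem gwQRefl_eq_headPart_add_tailPart {p : ℕ → ℝ} (hp : ∀ k, 0 ≤ p k) {ρ C : ℝ} (hρ : 0 ≤ ρ)
    (hsum : Summable fun k : ℕ => p k * Real.exp (ρ * k)) {f : ℕ → ℝ} (h : ExpGrowth ρ C f)
    (n z : ℕ) :
    gwQRefl p f z = gwQRefl p (headPart n f) z + gwQRefl p (tailPart n f) z := by
  unfold gwQRefl
  rw [← ((h.headPart n).summable_gwQRefl hp hρ hsum z).tsum_add
    ((h.tailPart le_rfl n).summable_gwQRefl hp hρ hsum z)]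
  refine tsum_congr fun k => ?_
  rw [← mul_add]
  congr 1
  split_ifs
  · have h1 := congrFun (headPart_add_tailPart n f) (z + k - 1)
    have h2 := congrFun (headPart_add_tailPart n f) z
    rw [Pi.add_apply] at h1 h2
    linarith
  · simp

/-- Exponential moment bounds, at the rates below `σ'`, for a semigroup on `ℕ`. -/
def HasExpMoments (R : MarkovSemigroup ℕ) (σ' : ℝ) : Prop :=
  ∀ ρ, 0 < ρ → ρ < σ' → ∀ x t, 0 ≤ t → Integrable (fun y : ℕ => Real.exp (ρ * y)) (R.P t x) ∧
    ∫ y : ℕ, Real.exp (ρ * y) ∂ R.P t x ≤ Real.exp ((Real.exp ρ - 1) * t) * Real.exp (ρ * x)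

theorem HasExpMoments.integrable {R : MarkovSemigroup ℕ} {σ' ρ C t : ℝ} (hM : HasExpMoments R σ')
    (hρ : 0 < ρ) (hρσ : ρ < σ') {f : ℕ → ℝ} (h : ExpGrowth ρ C f) (x : ℕ) (ht : 0 ≤ t) :
    Integrable f (R.P t x) :=
  ((hM ρ hρ hρσ x t ht).1.const_mul C).mono' Measurable.of_discrete.aestronglyMeasurable
    (ae_of_all _ h)

theorem HasExpMoments.expGrowth {R : MarkovSemigroup ℕ} {σ' ρ C t : ℝ} (hM : HasExpMoments R σ')
    (hρ : 0 < ρ) (hρσ : ρ < σ') {f : ℕ → ℝ} (h : ExpGrowth ρ C f) (ht : 0 ≤ t) :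
    ExpGrowth ρ (C * Real.exp ((Real.exp ρ - 1) * t)) fun x => ∫ y, f y ∂ R.P t x := by
  intro x
  obtain ⟨hint, hle⟩ := hM ρ hρ hρσ x t ht
  calc |∫ y, f y ∂ R.P t x| ≤ ∫ y : ℕ, C * Real.exp (ρ * y) ∂ R.P t x :=
        norm_integral_le_of_norm_le (f := f) (hint.const_mul C) (ae_of_all _ fun y => h y)
    _ = C * ∫ y : ℕ, Real.exp (ρ * y) ∂ R.P t x := integral_const_mul _ _
    _ ≤ C * (Real.exp ((Real.exp ρ - 1) * t) * Real.exp (ρ * x)) :=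
        mul_le_mul_of_nonneg_left hle h.nonneg
    _ = _ := by ring

/-- Tail contributions vanish locally uniformly in time. -/
theorem HasExpMoments.abs_integral_le {R : MarkovSemigroup ℕ} {σ' ρ C T t : ℝ}
    (hM : HasExpMoments R σ') (hρ : 0 < ρ) (hρσ : ρ < σ') {f : ℕ → ℝ} (h : ExpGrowth ρ C f)
    (x : ℕ) (ht : 0 ≤ t) (htT : t ≤ T) :
    |∫ y, f y ∂ R.P t x| ≤ C * (Real.exp ((Real.exp ρ - 1) * T) * Real.exp (ρ * x)) := by
  refine (hM.expGrowth hρ hρσ h ht x).trans ?_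
  rw [mul_assoc]
  have : 0 ≤ Real.exp ρ - 1 := sub_nonneg.2 (Real.one_le_exp hρ.le)
  have hC := h.nonneg
  gcongr

theorem tendsto_mul_exp_neg_mul_nat (C K : ℝ) {ε : ℝ} (hε : 0 < ε) :
    Tendsto (fun n : ℕ => C * Real.exp (-ε * n) * K) atTop (𝓝 0) := by
  have h : Tendsto (fun n : ℕ => Real.exp (-ε * n)) atTop (𝓝 0) :=
    Real.tendsto_exp_atBot.comp
      (tendsto_natCast_atTop_atTop.const_mul_atTop_of_neg (neg_lt_zero.2 hε))
  simpa using (h.const_mul C).mul_const K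

theorem IsReflSemigroup.continuousWithinAt_integral {p : ℕ → ℝ} {R : MarkovSemigroup ℕ}
    (hR : IsReflSemigroup p R) {σ' ρ C t : ℝ} (hM : HasExpMoments R σ') (hρ : 0 < ρ)
    (hρσ : ρ < σ') {f : ℕ → ℝ} (h : ExpGrowth ρ C f) (x : ℕ) (ht : 0 ≤ t) :
    ContinuousWithinAt (fun u => ∫ y, f y ∂ R.P u x) (Ici 0) t := by
  obtain ⟨ρ', hρ', hρσ'⟩ := exists_between hρσ
  have hρ0 := hρ.trans hρ'
  refine continuousWithinAt_of_locally_uniform_approx_of_continuousWithinAt (mem_Ici.2 ht)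
    fun U hU => ?_
  obtain ⟨ε, hε, hεU⟩ := Metric.mem_uniformity_dist.1 hU
  have hlim := tendsto_mul_exp_neg_mul_nat C
    (Real.exp ((Real.exp ρ' - 1) * (t + 1)) * Real.exp (ρ' * x)) (sub_pos.2 hρ')
  obtain ⟨n, hn⟩ := (hlim.eventually (eventually_lt_nhds hε)).exists
  refine ⟨Ici 0 ∩ Iio (t + 1), inter_mem_nhdsWithin _ (Iio_mem_nhds (by linarith)),
    fun u => ∫ y, headPart n f y ∂ R.P u x,
    (hR _ (headPart_bounded n f) x t ht).continuousWithinAt, fun u hu => hεU ?_⟩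
  have := R.prob u x
  rw [Real.dist_eq, ← integral_sub (hM.integrable hρ hρσ h x hu.1)
    ((headPart_bounded n f).integrable _)]
  have heq : ∀ y, f y - headPart n f y = tailPart n f y := fun y => by
    have := congrFun (headPart_add_tailPart n f) y
    rw [Pi.add_apply] at this
    linarith
  simp only [heq]
  exact (hM.abs_integral_le hρ0 hρσ' (h.tailPart hρ'.le n) x hu.1 (le_of_lt hu.2)).trans_lt hn

/-- The forward Kolmogorov equation on functions of exponential growth. -/
theorem IsReflSemigroup.hasDerivWithinAt_integral {p : ℕ → ℝ} {R : MarkovSemigroup ℕ}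
    (hR : IsReflSemigroup p R) (hp : ∀ k, 0 ≤ p k) {σ' ρ C t : ℝ} (hM : HasExpMoments R σ')
    (hsum : ∀ ρ, 0 < ρ → ρ < σ' → Summable fun k : ℕ => p k * Real.exp (ρ * k))
    (hρ : 0 < ρ) (hρσ : ρ < σ') {f : ℕ → ℝ} (h : ExpGrowth ρ C f) (x : ℕ) (ht : 0 ≤ t) :
    HasDerivWithinAt (fun u => ∫ y, f y ∂ R.P u x) (∫ y, gwQRefl p f y ∂ R.P t x) (Ici 0) t := by
  obtain ⟨ρ₁, hρ₁, hρσ₁⟩ := exists_between hρσ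
  obtain ⟨ρ₂, hρ₂, hρσ₂⟩ := exists_between hρσ₁
  have h0₁ := hρ.trans hρ₁
  have h0₂ := h0₁.trans hρ₂
  have hQ := h.gwQRefl hp hρ.le hρ₁ (hsum ρ hρ hρσ)
  refine hasDerivWithinAt_Ici_of_tendsto_prod ht
    (F := fun n u => ∫ y, headPart n f y ∂ R.P u x)
    (G := fun n u => ∫ y, gwQRefl p (headPart n f) y ∂ R.P u x)
    (fun n s hs => hR _ (headPart_bounded n f) x s hs) (fun s hs => ?_) ?_
  · refine tendsto_integral_of_dominated_convergence (fun y : ℕ => C * Real.exp (ρ * y))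
      (fun n => Measurable.of_discrete.aestronglyMeasurable)
      ((hM ρ hρ hρσ x s hs).1.const_mul C) (fun n => ae_of_all _ (h.headPart n))
      (ae_of_all _ fun y => ?_)
    refine tendsto_const_nhds.congr' ?_
    filter_upwards [eventually_ge_atTop y] with n hn
    exact (if_pos hn).symm
  · have hcont : Tendsto (fun q : ℕ × ℝ => ∫ y, gwQRefl p f y ∂ R.P q.2 x) (atTop ×ˢ 𝓝[Ici 0] t)
        (𝓝 (∫ y, gwQRefl p f y ∂ R.P t x)) :=
      (hR.continuousWithinAt_integral hM h0₁ hρσ₁ hQ x ht).tendsto.comp tendsto_snd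
    have hdiff : Tendsto (fun q : ℕ × ℝ => ∫ y, gwQRefl p f y ∂ R.P q.2 x -
        ∫ y, gwQRefl p (headPart q.1 f) y ∂ R.P q.2 x) (atTop ×ˢ 𝓝[Ici 0] t) (𝓝 0) := by
      have hlim := (tendsto_mul_exp_neg_mul_nat C
        ((2 * (∑' k : ℕ, p k * Real.exp (ρ₁ * k)) / (ρ₂ - ρ₁)) *
          (Real.exp ((Real.exp ρ₂ - 1) * (t + 1)) * Real.exp (ρ₂ * x))) (sub_pos.2 hρ₁)).comp
        (tendsto_fst (f := atTop) (g := 𝓝[Ici 0] t))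
      refine squeeze_zero_norm' ?_ hlim
      have hev : ∀ᶠ u in 𝓝[Ici 0] t, u ∈ Ici 0 ∩ Iio (t + 1) :=
        inter_mem_nhdsWithin _ (Iio_mem_nhds (by linarith))
      filter_upwards [tendsto_snd.eventually hev] with q hq
      have := R.prob q.2 x
      rw [← integral_sub (hM.integrable h0₁ hρσ₁ hQ x hq.1)
        ((gwQRefl_headPart_bounded p q.1 f).integrable _)]
      have heq : ∀ y, gwQRefl p f y - gwQRefl p (headPart q.1 f) y =
          gwQRefl p (tailPart q.1 f) y := fun y => by
        rw [gwQRefl_eq_headPart_add_tailPart hp hρ.le (hsum ρ hρ hρσ) h q.1 y]; ring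
      simp only [heq]
      have hT := (h.tailPart hρ₁.le q.1).gwQRefl hp h0₁.le hρ₂ (hsum ρ₁ h0₁ hρσ₁)
      refine (hM.abs_integral_le h0₂ hρσ₂ hT x hq.1 (le_of_lt hq.2)).trans (le_of_eq ?_)
      simp only [Function.comp_apply]
      ring
    simpa using hcont.sub hdiff

theorem MarkovSemigroup.integral_add {S : Type*} [MeasurableSpace S] (R : MarkovSemigroup S)
    {s t : ℝ} (hs : 0 ≤ s) (ht : 0 ≤ t) (x : S) {f : S → ℝ} (hf : Integrable f (R.P (s + t) x)) :
    ∫ y, f y ∂ R.P (s + t) x = ∫ y, ∫ z, f z ∂ R.P t y ∂ R.P s x := by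
  let κ : ProbabilityTheory.Kernel S S := ⟨R.P s, R.meas s⟩
  let η : ProbabilityTheory.Kernel S S := ⟨R.P t, R.meas t⟩
  have hc : (η.comp κ) x = R.P (s + t) x := by
    rw [ProbabilityTheory.Kernel.comp_apply, R.semigroup s t hs ht x]; rfl
  have := ProbabilityTheory.Kernel.integral_comp (κ := κ) (η := η) (a := x) (f := f) (hc ▸ hf)
  rwa [hc] at this

theorem MemF.exists_expGrowth {σ' : ℝ} (hσ' : 0 < σ') {f : ℕ → ℝ} (hf : MemF σ' f) :
    ∃ ρ C, 0 < ρ ∧ ρ < σ' ∧ ExpGrowth ρ C f := by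
  obtain ⟨ρ, hρ, hs⟩ := hf
  have hnn : ∀ ℓ : ℕ, 0 ≤ Real.exp (-ρ * ℓ) * |f ℓ| := fun ℓ =>
    mul_nonneg (Real.exp_pos _).le (abs_nonneg _)
  refine ⟨max ρ (σ' / 2), ∑' ℓ : ℕ, Real.exp (-ρ * ℓ) * |f ℓ|,
    lt_max_of_lt_right (half_pos hσ'), max_lt hρ (half_lt_self hσ'), fun y => ?_⟩
  have h1 := hs.le_tsum y fun j _ => hnn j
  calc |f y| = Real.exp (-ρ * y) * |f y| * Real.exp (ρ * y) := by
        have : Real.exp (-ρ * y) * Real.exp (ρ * y) = 1 := by rw [← Real.exp_add]; simp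
        rw [mul_right_comm, this, one_mul]
    _ ≤ (∑' ℓ : ℕ, Real.exp (-ρ * ℓ) * |f ℓ|) * Real.exp (max ρ (σ' / 2) * y) := by
        refine mul_le_mul h1 (Real.exp_le_exp.2 ?_) (Real.exp_pos _).le (tsum_nonneg hnn)
        exact mul_le_mul_of_nonneg_right (le_max_left _ _) (Nat.cast_nonneg _)

/-- **Kolmogorov equations for the reflected Galton-Watson semigroup on the
class `F`.** If `E exp(σ' H¹) < ∞` (with `H¹` the total number of births,
encoded through the birth-counting process `W`), then every `f` with
`∑_ℓ e^{-ρℓ}|f(ℓ)| < ∞` for some `ρ < σ'` satisfies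
`d/dt S̃_t f = Q̃ S̃_t f = S̃_t Q̃ f` for the reflected generator `Q̃`. -/
theorem gw_reflected_kolmogorov_equations
    (p : ℕ → ℝ) (σ v : ℝ) (hp : OffspringLaw p σ v)
    (W : MarkovSemigroup (ℕ × ℕ)) (hW : IsGWBSemigroup p W)
    (σ' : ℝ) (hσ' : 0 < σ') (hH : HMomentFinite W σ')
    (R : MarkovSemigroup ℕ) (hR : IsReflSemigroup p R)
    (f : ℕ → ℝ) (hf : MemF σ' f) :
    ∀ x : ℕ, ∀ t : ℝ, 0 ≤ t →
      HasDerivWithinAt (fun u => ∫ y, f y ∂ R.P u x)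
        (gwQRefl p (fun y => ∫ z, f z ∂ R.P t y) x) (Set.Ici 0) t ∧
      gwQRefl p (fun y => ∫ z, f z ∂ R.P t y) x
        = ∫ y, gwQRefl p f y ∂ R.P t x := by
  have hp0 := hp.nonneg
  have hs := hp.summable
  have htilt := fun ρ (h0 : 0 < ρ) (h1 : ρ < σ') =>
    summable_tilt_of_cappedTilt_le_one hs hp0 h0.le (cappedTilt_le_one hH hW hp0 hs hp.total h0 h1)
  have hsum : ∀ ρ, 0 < ρ → ρ < σ' → Summable fun k : ℕ => p k * Real.exp (ρ * k) := by
    intro ρ h0 h1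
    refine ((htilt ρ h0 h1).1.mul_right (Real.exp ρ)).congr fun k => ?_
    rw [mul_assoc, ← Real.exp_add]
    congr 2
    ring
  have hM : HasExpMoments R σ' := fun ρ h0 h1 x t ht =>
    hR.integral_exp_le hp0 hs hp.total h0.le (htilt ρ h0 h1).1 (htilt ρ h0 h1).2 x ht
  obtain ⟨ρ, C, hρ, hρσ, hfC⟩ := hf.exists_expGrowth hσ'
  intro x t ht
  have hfwd := hR.hasDerivWithinAt_integral hp0 hM hsum hρ hρσ hfC x ht
  have hback := hR.hasDerivWithinAt_integral hp0 hM hsum hρ hρσ (hM.expGrowth hρ hρσ hfC ht) x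
    le_rfl
  rw [R.init, integral_dirac] at hback
  have hshift : HasDerivWithinAt (fun h => ∫ y, f y ∂ R.P (h + t) x)
      (∫ y, gwQRefl p f y ∂ R.P t x) (Ici 0) 0 := by
    have hadd : HasDerivWithinAt (fun h : ℝ => h + t) 1 (Ici 0) 0 :=
      (hasDerivWithinAt_id 0 _).add_const t
    have hmaps : MapsTo (fun h : ℝ => h + t) (Ici 0) (Ici 0) := fun h hh => add_nonneg hh ht
    have hfwd' : HasDerivWithinAt (fun u => ∫ y, f y ∂ R.P u x) (∫ y, gwQRefl p f y ∂ R.P t x)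
        (Ici 0) ((fun h : ℝ => h + t) 0) := by simpa using hfwd
    simpa [Function.comp_def] using hfwd'.comp (0 : ℝ) hadd hmaps
  have heq : gwQRefl p (fun y => ∫ z, f z ∂ R.P t y) x = ∫ y, gwQRefl p f y ∂ R.P t x := by
    refine (uniqueDiffOn_Ici (0 : ℝ) 0 (mem_Ici.2 le_rfl)).eq_deriv (Ici 0) hback
      (hshift.congr_of_mem (fun h hh => ?_) (mem_Ici.2 le_rfl))
    exact (R.integral_add hh ht x (hM.integrable hρ hρσ hfC x (add_nonneg hh ht))).symm
  exact ⟨heq ▸ hfwd, heq⟩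

end
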